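/- The following hold. (i) ℝ^{2d} = Ω_b⁺ ⊔ Ω_∞⁺ and ℝ^{2d} = Ω_b⁻ ⊔ Ω_∞⁻ (disjoint unions); in particular ℝ^{2d} = Ω_b⁺ ∪ Ω_b⁻ ∪ Ω_∞. (ii) Ω_∞⁺, Ω_∞⁻ and Ω_∞ are open subsets of ℝ^{2d}, and Ω_b⁺, Ω_b⁻ and Ω_b are closed. (iii) If K is a compact subset of Ω_∞, then for every R ≥ 0 there exists T ≥ 0 such that |X(t,v)| ≥ R for all v ∈ K and all t ∈ ℝ with |t| ≥ T; moreover the set ⋃_{t∈ℝ} φ^{−t}(K) is closed in ℝ^{2d}. -/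

import Mathlib

open MeasureTheory Complex Filter
open scoped ENNReal NNReal Topology

noncomputable section

/-- Euclidean space `ℝ^d`. -/
abbrev Ed (d : ℕ) := EuclideanSpace ℝ (Fin d)

/-- The Japanese bracket `⟨x⟩ = (1 + |x|²)^(1/2)`. -/
def jap {d : ℕ} (x : Ed d) : ℝ := Real.sqrt (1 + ‖x‖ ^ 2)

/-- The geometric data of the problem: a long-range perturbation `G` of the identity matrix
(smooth, symmetric, positive definite, with symbol-like decay of all derivatives) and a
short-range nonnegative smooth absorption index `a`. -/
structure GeomSetup (d : ℕ) : Type where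
  G : Ed d → Matrix (Fin d) (Fin d) ℝ
  a : Ed d → ℝ
  ρ : ℝ
  ρ_pos : 0 < ρ
  G_smooth : ∀ j k, ContDiff ℝ (⊤ : ℕ∞) fun x => G x j k
  G_symm : ∀ x, (G x).IsSymm
  G_posdef : ∀ x, (G x).PosDef
  G_decay : ∀ n : ℕ, ∃ c : ℝ, ∀ j k, ∀ x : Ed d,
    ‖iteratedFDeriv ℝ n (fun y : Ed d => G y j k - if j = k then (1 : ℝ) else 0) x‖
      ≤ c * jap x ^ (-ρ - (n : ℝ))
  a_smooth : ContDiff ℝ (⊤ : ℕ∞) a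
  a_nonneg : ∀ x, 0 ≤ a x
  a_decay : ∀ n : ℕ, ∃ c : ℝ, ∀ x : Ed d,
    ‖iteratedFDeriv ℝ n a x‖ ≤ c * jap x ^ (-1 - ρ - (n : ℝ))

/-- The principal symbol `p(x,ξ) = ⟨G(x)ξ, ξ⟩`. -/
def pHam {d : ℕ} (S : GeomSetup d) (w : Ed d × Ed d) : ℝ :=
  ∑ j, ∑ k, S.G w.1 j k * w.2 j * w.2 k

/-- `Φ` is the (globally defined) Hamiltonian flow of `p`:
`∂_t X = ∇_ξ p`, `∂_t Ξ = -∇_x p`, `Φ⁰ = id`. -/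
def IsHamFlow {d : ℕ} (S : GeomSetup d) (Φ : ℝ → Ed d × Ed d → Ed d × Ed d) : Prop :=
  (∀ w, Φ 0 w = w) ∧
  ∀ w t, HasDerivAt (fun s => Φ s w)
    (gradient (fun ξ => pHam S ((Φ t w).1, ξ)) (Φ t w).2,
     -gradient (fun x => pHam S (x, (Φ t w).2)) (Φ t w).1) t

/-- The forward (`σ = 1`) and backward (`σ = -1`) trapped sets
`Ω_b^± = {w : sup_{t ≥ 0} |X(±t,w)| < ∞}`. -/
def OmegaB {d : ℕ} (Φ : ℝ → Ed d × Ed d → Ed d × Ed d) (σ : ℝ) : Set (Ed d × Ed d) :=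
  {w | ∃ M : ℝ, ∀ t : ℝ, 0 ≤ t → ‖(Φ (σ * t) w).1‖ ≤ M}

/-- The forward (`σ = 1`) and backward (`σ = -1`) non-trapped sets
`Ω_∞^± = {w : |X(±t,w)| → ∞ as t → ∞}`. -/
def OmegaInf {d : ℕ} (Φ : ℝ → Ed d × Ed d → Ed d × Ed d) (σ : ℝ) : Set (Ed d × Ed d) :=
  {w | Filter.Tendsto (fun t => ‖(Φ (σ * t) w).1‖) Filter.atTop Filter.atTop}

/-- Geometric control: every trapped trajectory of positive energy meets the damping
region `{a > 0}`. -/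
def GeoControl {d : ℕ} (S : GeomSetup d) (Φ : ℝ → Ed d × Ed d → Ed d × Ed d) : Prop :=
  ∀ w ∈ OmegaB Φ 1 ∩ OmegaB Φ (-1), 0 < pHam S w → ∃ t : ℝ, 0 < S.a ((Φ t w).1)

/-- The elementary operator `ξ ↦ ξ_k e_j`. -/
def elemOp {d : ℕ} (j k : Fin d) : Ed d →L[ℝ] Ed d :=
  (EuclideanSpace.proj k : Ed d →L[ℝ] ℝ).smulRight (EuclideanSpace.single j (1 : ℝ))

lemma sum_smul_elemOp_apply {d : ℕ} (g : Fin d → Fin d → ℝ) (ξ : Ed d) (i : Fin d) :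
    (∑ j, ∑ k, g j k • elemOp j k) ξ i = ∑ k, g i k * ξ k := by
  simp [elemOp, Pi.single_apply]

/-- The operator `ξ ↦ G(x) ξ`. -/
def GeomSetup.op {d : ℕ} (S : GeomSetup d) (x : Ed d) : Ed d →L[ℝ] Ed d :=
  ∑ j, ∑ k, S.G x j k • elemOp j k

namespace GeomSetup

variable {d : ℕ} (S : GeomSetup d)

lemma op_apply (x ξ : Ed d) (j : Fin d) : S.op x ξ j = ∑ k, S.G x j k * ξ k :=
  sum_smul_elemOp_apply _ ξ j

lemma inner_op (x ξ η : Ed d) :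
    inner ℝ (S.op x ξ) η = ∑ j, ∑ k, S.G x j k * ξ k * η j := by
  simp only [PiLp.inner_apply, op_apply, RCLike.inner_apply, conj_trivial, Finset.mul_sum]
  refine Finset.sum_congr rfl fun j _ => Finset.sum_congr rfl fun k _ => by ring

lemma op_symm (x ξ η : Ed d) : inner ℝ (S.op x ξ) η = inner ℝ ξ (S.op x η) := by
  rw [real_inner_comm (S.op x η) ξ, inner_op, inner_op, Finset.sum_comm]
  refine Finset.sum_congr rfl fun j _ => Finset.sum_congr rfl fun k _ => ?_
  rw [(S.G_symm x).apply j k]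
  ring

lemma pHam_eq (x ξ : Ed d) : pHam S (x, ξ) = inner ℝ (S.op x ξ) ξ := by
  rw [inner_op]
  refine Finset.sum_congr rfl fun j _ => Finset.sum_congr rfl fun k _ => by simp; ring

lemma op_pos (x : Ed d) {ξ : Ed d} (hξ : ξ ≠ 0) : 0 < inner ℝ (S.op x ξ) ξ := by
  have h := (S.G_posdef x).dotProduct_mulVec_pos (x := fun i => ξ i)
    (fun h => hξ (by ext i; exact congrFun h i))
  rw [inner_op]
  simp only [dotProduct, Matrix.mulVec, Finset.mul_sum, Pi.star_apply, star_trivial] at h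
  refine h.trans_eq (Finset.sum_congr rfl fun j _ => Finset.sum_congr rfl fun k _ => by ring)

lemma op_contDiff : ContDiff ℝ (⊤ : ℕ∞) S.op := by
  unfold op
  exact ContDiff.sum fun j _ => ContDiff.sum fun k _ => (S.G_smooth j k).smul contDiff_const

lemma op_differentiable : Differentiable ℝ S.op :=
  S.op_contDiff.differentiable (by simp)

lemma pHam_contDiff : ContDiff ℝ (⊤ : ℕ∞) (pHam S) := by
  have h : pHam S = fun w => inner ℝ (S.op w.1 w.2) w.2 := by
    funext w; exact S.pHam_eq w.1 w.2
  rw [h]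
  exact ((S.op_contDiff.comp contDiff_fst).clm_apply contDiff_snd).inner ℝ contDiff_snd

lemma op_sub_id (x : Ed d) : S.op x - ContinuousLinearMap.id ℝ (Ed d) =
    ∑ j, ∑ k, (S.G x j k - if j = k then (1 : ℝ) else 0) • elemOp j k := by
  have h : ContinuousLinearMap.id ℝ (Ed d) =
      ∑ j, ∑ k, (if j = k then (1 : ℝ) else 0) • elemOp j k := by
    ext ξ i
    rw [sum_smul_elemOp_apply]
    simp
  rw [h, op, ← Finset.sum_sub_distrib]
  refine Finset.sum_congr rfl fun j _ => ?_
  rw [← Finset.sum_sub_distrib]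
  exact Finset.sum_congr rfl fun k _ => (sub_smul _ _ _).symm

lemma exists_norm_op_sub_id_le :
    ∃ C : ℝ, ∀ x, ‖S.op x - ContinuousLinearMap.id ℝ (Ed d)‖ ≤ C * jap x ^ (-S.ρ) := by
  obtain ⟨c, hc⟩ := S.G_decay 0
  refine ⟨∑ j : Fin d, ∑ k : Fin d, c * ‖(elemOp j k : Ed d →L[ℝ] Ed d)‖, fun x => ?_⟩
  rw [op_sub_id, Finset.sum_mul]
  refine norm_sum_le_of_le _ fun j _ => ?_
  rw [Finset.sum_mul]
  refine norm_sum_le_of_le _ fun k _ => ?_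
  have := hc j k x
  rw [norm_iteratedFDeriv_zero] at this
  rw [norm_smul]
  calc _ ≤ (c * jap x ^ (-S.ρ - ((0 : ℕ) : ℝ))) * ‖(elemOp j k : Ed d →L[ℝ] Ed d)‖ := by gcongr
    _ = _ := by simp; ring

lemma exists_norm_fderiv_op_le :
    ∃ C : ℝ, ∀ x, ‖fderiv ℝ S.op x‖ ≤ C * jap x ^ (-S.ρ - 1) := by
  obtain ⟨c, hc⟩ := S.G_decay 1
  refine ⟨∑ j : Fin d, ∑ k : Fin d, c * ‖(elemOp j k : Ed d →L[ℝ] Ed d)‖, fun x => ?_⟩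
  have hd : HasFDerivAt S.op (∑ j, ∑ k,
      (fderiv ℝ (fun y : Ed d => S.G y j k) x).smulRight (elemOp j k)) x := by
    unfold op
    refine HasFDerivAt.fun_sum fun j _ => HasFDerivAt.fun_sum fun k _ => ?_
    exact (((S.G_smooth j k).differentiable (by simp)) x).hasFDerivAt.smul_const (elemOp j k)
  rw [hd.fderiv, Finset.sum_mul]
  refine (norm_sum_le (E := Ed d →L[ℝ] Ed d →L[ℝ] Ed d) Finset.univ _).trans
    (Finset.sum_le_sum fun j _ => ?_)
  rw [Finset.sum_mul]
  refine (norm_sum_le (E := Ed d →L[ℝ] Ed d →L[ℝ] Ed d) Finset.univ _).trans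
    (Finset.sum_le_sum fun k _ => ?_)
  have := hc j k x
  rw [norm_iteratedFDeriv_one, fderiv_sub_const] at this
  rw [ContinuousLinearMap.norm_smulRight_apply]
  calc _ ≤ (c * jap x ^ (-S.ρ - ((1 : ℕ) : ℝ))) * ‖(elemOp j k : Ed d →L[ℝ] Ed d)‖ := by gcongr
    _ = _ := by simp; ring

end GeomSetup

lemma norm_le_jap {d : ℕ} (x : Ed d) : ‖x‖ ≤ jap x :=
  Real.le_sqrt_of_sq_le (by linarith)

lemma jap_pos {d : ℕ} (x : Ed d) : 0 < jap x := Real.sqrt_pos.2 (by positivity)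

/-- Negative powers of the Japanese bracket are small outside a large ball. -/
lemma exists_jap_rpow_le {d : ℕ} {ρ : ℝ} (hρ : 0 < ρ) (C : ℝ) {ε : ℝ} (hε : 0 < ε) :
    ∃ R : ℝ, ∀ x : Ed d, R ≤ ‖x‖ → C * jap x ^ (-ρ) ≤ ε := by
  have h : Tendsto (fun r : ℝ => C * r ^ (-ρ)) atTop (𝓝 0) := by
    simpa using (tendsto_rpow_neg_atTop hρ).const_mul C
  obtain ⟨R, hR⟩ := eventually_atTop.1 (h.eventually_le_const hε)
  exact ⟨R, fun x hx => hR _ (hx.trans (norm_le_jap x))⟩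

namespace GeomSetup

variable {d : ℕ} (S : GeomSetup d)

/-- Outside a large ball the metric is close to the flat one. -/
lemma exists_near_flat : ∃ R : ℝ, ∀ x : Ed d, R ≤ ‖x‖ →
    ‖S.op x - ContinuousLinearMap.id ℝ (Ed d)‖ ≤ 1 / 4 ∧ ‖x‖ * ‖fderiv ℝ S.op x‖ ≤ 1 / 8 := by
  obtain ⟨C₀, h₀⟩ := S.exists_norm_op_sub_id_le
  obtain ⟨C₁, h₁⟩ := S.exists_norm_fderiv_op_le
  obtain ⟨R₀, hR₀⟩ := exists_jap_rpow_le (d := d) S.ρ_pos C₀ (ε := 1 / 4) (by norm_num)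
  obtain ⟨R₁, hR₁⟩ := exists_jap_rpow_le (d := d) S.ρ_pos C₁ (ε := 1 / 8) (by norm_num)
  refine ⟨max R₀ R₁, fun x hx => ⟨(h₀ x).trans (hR₀ x ((le_max_left _ _).trans hx)), ?_⟩⟩
  calc ‖x‖ * ‖fderiv ℝ S.op x‖ ≤ jap x * (C₁ * jap x ^ (-S.ρ - 1)) :=
        mul_le_mul (norm_le_jap x) (h₁ x) (norm_nonneg (fderiv ℝ S.op x)) (jap_pos x).le
    _ = C₁ * jap x ^ (-S.ρ) := by
        rw [Real.rpow_sub_one (jap_pos x).ne']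
        field_simp [(jap_pos x).ne']
    _ ≤ 1 / 8 := hR₁ x ((le_max_right _ _).trans hx)

lemma norm_op_bounds {x : Ed d}
    (hx : ‖S.op x - ContinuousLinearMap.id ℝ (Ed d)‖ ≤ 1 / 4) (ξ : Ed d) :
    ‖S.op x ξ - ξ‖ ≤ 1 / 4 * ‖ξ‖ := by
  simpa using (S.op x - ContinuousLinearMap.id ℝ (Ed d)).le_of_opNorm_le hx ξ

lemma exists_norm_op_le : ∃ M : ℝ, 0 ≤ M ∧ ∀ x : Ed d, ‖S.op x‖ ≤ M := by
  obtain ⟨R, hR⟩ := S.exists_near_flat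
  obtain ⟨C, hC⟩ := (isCompact_closedBall (0 : Ed d) R).exists_bound_of_continuousOn
    S.op_contDiff.continuous.continuousOn
  refine ⟨max C 2, by positivity, fun x => ?_⟩
  rcases le_total ‖x‖ R with h | h
  · exact (hC x (by simpa using h)).trans (le_max_left _ _)
  · refine le_trans ?_ (le_max_right _ _)
    refine ContinuousLinearMap.opNorm_le_bound _ (by norm_num) fun ξ => ?_
    have h₁ := S.norm_op_bounds (hR x h).1 ξ
    have h₂ := norm_le_norm_add_norm_sub' (S.op x ξ) ξ
    linarith [norm_nonneg ξ]

/-- Uniform ellipticity. -/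
lemma exists_elliptic : ∃ m : ℝ, 0 < m ∧ ∀ x ξ : Ed d, m * ‖ξ‖ ^ 2 ≤ inner ℝ (S.op x ξ) ξ := by
  obtain ⟨R, hR⟩ := S.exists_near_flat
  have hcont : Continuous fun w : Ed d × Ed d => (inner ℝ (S.op w.1 w.2) w.2 : ℝ) :=
    ((S.op_contDiff.continuous.comp continuous_fst).clm_apply continuous_snd).inner continuous_snd
  obtain ⟨m, hm, hmin⟩ := ((isCompact_closedBall (0 : Ed d) R).prod
    (isCompact_sphere (0 : Ed d) 1)).exists_forall_le' hcont.continuousOn (a := 0) (by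
      rintro ⟨x, ξ⟩ ⟨-, hξ⟩
      exact S.op_pos x (ne_zero_of_mem_unit_sphere ⟨ξ, hξ⟩))
  refine ⟨min m (1 / 2), by positivity, fun x ξ => ?_⟩
  rcases le_total ‖x‖ R with h | h
  · refine (mul_le_mul_of_nonneg_right (min_le_left _ _) (sq_nonneg _)).trans ?_
    rcases eq_or_ne ξ 0 with rfl | hξ
    · simp
    · have hn : ‖ξ‖ ≠ 0 := norm_ne_zero_iff.2 hξ
      have := hmin (x, ‖ξ‖⁻¹ • ξ) ⟨by simpa using h, by simp [norm_smul, hn]⟩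
      simp only [map_smul, inner_smul_left, inner_smul_right, conj_trivial] at this
      calc m * ‖ξ‖ ^ 2 ≤ (‖ξ‖⁻¹ * (‖ξ‖⁻¹ * inner ℝ (S.op x ξ) ξ)) * ‖ξ‖ ^ 2 := by gcongr
        _ = _ := by field_simp
  · refine (mul_le_mul_of_nonneg_right (min_le_right _ _) (sq_nonneg _)).trans ?_
    have h₁ := S.norm_op_bounds (hR x h).1 ξ
    have h₂ := (abs_le.1 (abs_real_inner_le_norm (S.op x ξ - ξ) ξ)).1
    rw [inner_sub_left, real_inner_self_eq_norm_sq] at h₂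
    nlinarith [norm_nonneg ξ]

/-- The Hamiltonian vector field of `p`. -/
def hamField (w : Ed d × Ed d) : Ed d × Ed d :=
  (gradient (fun ξ => pHam S (w.1, ξ)) w.2, -gradient (fun x => pHam S (x, w.2)) w.1)

lemma hamField_fst (w : Ed d × Ed d) : (S.hamField w).1 = (2 : ℝ) • S.op w.1 w.2 := by
  refine HasGradientAt.gradient ?_
  rw [hasGradientAt_iff_hasFDerivAt]
  simp only [pHam_eq]
  have h := (S.op w.1).hasFDerivAt (x := w.2) |>.inner ℝ (hasFDerivAt_id w.2)
  refine h.congr_fderiv ?_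
  ext η
  simp [fderivInnerCLM_apply, S.op_symm w.1 η, real_inner_comm]
  ring

lemma inner_hamField_snd (w : Ed d × Ed d) (e : Ed d) :
    inner ℝ (S.hamField w).2 e = -inner ℝ (fderiv ℝ S.op w.1 e w.2) w.2 := by
  have h : HasFDerivAt (fun x => pHam S (x, w.2))
      ((innerSL ℝ w.2).comp ((fderiv ℝ S.op w.1).flip w.2)) w.1 := by
    simp only [pHam_eq]
    have h₁ := (S.op_differentiable w.1).hasFDerivAt.clm_apply (hasFDerivAt_const w.2 w.1)
    refine (h₁.inner ℝ (hasFDerivAt_const w.2 w.1)).congr_fderiv ?_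
    ext η
    simp [fderivInnerCLM_apply, real_inner_comm]
  simp only [hamField, gradient, h.fderiv, inner_neg_left,
    InnerProductSpace.toDual_symm_apply, ContinuousLinearMap.comp_apply, innerSL_apply_apply,
    ContinuousLinearMap.flip_apply, real_inner_comm]

lemma hamField_contDiff : ContDiff ℝ 1 S.hamField := by
  have h₁ : ContDiff ℝ 1 fun w : Ed d × Ed d => fderiv ℝ (fun ξ => pHam S (w.1, ξ)) w.2 :=
    ContDiff.fderiv (n := 1) (m := (⊤ : ℕ∞))
      (S.pHam_contDiff.comp ((contDiff_fst.comp contDiff_fst).prodMk contDiff_snd))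
      contDiff_snd (WithTop.coe_le_coe.2 (le_top : (1 + 1 : ℕ∞) ≤ ⊤))
  have h₂ : ContDiff ℝ 1 fun w : Ed d × Ed d => fderiv ℝ (fun x => pHam S (x, w.2)) w.1 :=
    ContDiff.fderiv (n := 1) (m := (⊤ : ℕ∞))
      (S.pHam_contDiff.comp (contDiff_snd.prodMk (contDiff_snd.comp contDiff_fst)))
      contDiff_fst (WithTop.coe_le_coe.2 (le_top : (1 + 1 : ℕ∞) ≤ ⊤))
  exact ((InnerProductSpace.toDual ℝ (Ed d)).symm.contDiff.comp h₁).prodMk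
    ((InnerProductSpace.toDual ℝ (Ed d)).symm.contDiff.comp h₂).neg

end GeomSetup

namespace GeomSetup

variable {d : ℕ} (S : GeomSetup d)

/-- A quarter of the second derivative of `‖X‖²` along the flow is nonnegative far from the origin. -/
lemma radial_convexity {w : Ed d × Ed d}
    (h₀ : ‖S.op w.1 - ContinuousLinearMap.id ℝ (Ed d)‖ ≤ 1 / 4)
    (h₁ : ‖w.1‖ * ‖fderiv ℝ S.op w.1‖ ≤ 1 / 8) :
    0 ≤ inner ℝ w.1 (fderiv ℝ S.op w.1 (S.hamField w).1 w.2 + S.op w.1 (S.hamField w).2) +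
      inner ℝ (S.hamField w).1 (S.op w.1 w.2) := by
  rw [inner_add_right, ← S.op_symm, real_inner_comm (S.hamField w).2, inner_hamField_snd,
    hamField_fst]
  obtain ⟨x, ξ⟩ := w
  simp only at h₀ h₁ ⊢
  simp only [map_smul, smul_apply, inner_smul_left, inner_smul_right,
    conj_trivial, real_inner_self_eq_norm_sq]
  set D := fderiv ℝ S.op x
  have hD : ∀ u : Ed d, ‖D u ξ‖ ≤ ‖D‖ * ‖u‖ * ‖ξ‖ := fun u => D.le_opNorm₂ u ξ
  have hn : ∀ u : Ed d, 3 / 4 * ‖u‖ ≤ ‖S.op x u‖ ∧ ‖S.op x u‖ ≤ 5 / 4 * ‖u‖ := fun u => by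
    have a₁ := S.norm_op_bounds h₀ u
    have a₂ := norm_le_norm_add_norm_sub' (S.op x u) u
    have a₃ := norm_le_norm_add_norm_sub (S.op x u) u
    constructor <;> linarith
  have e₁ : |inner ℝ x (D (S.op x ξ) ξ)| ≤ 5 / 32 * ‖ξ‖ ^ 2 := by
    calc _ ≤ ‖x‖ * ‖D (S.op x ξ) ξ‖ := abs_real_inner_le_norm _ _
      _ ≤ ‖x‖ * (‖D‖ * (5 / 4 * ‖ξ‖) * ‖ξ‖) := by
          refine mul_le_mul_of_nonneg_left ((hD _).trans ?_) (norm_nonneg _)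
          gcongr
          exact (hn ξ).2
      _ = (‖x‖ * ‖D‖) * (5 / 4 * ‖ξ‖ ^ 2) := by ring
      _ ≤ 1 / 8 * (5 / 4 * ‖ξ‖ ^ 2) := by gcongr
      _ = _ := by ring
  have e₂ : |inner ℝ (D (S.op x x) ξ) ξ| ≤ 5 / 32 * ‖ξ‖ ^ 2 := by
    calc _ ≤ ‖D (S.op x x) ξ‖ * ‖ξ‖ := abs_real_inner_le_norm _ _
      _ ≤ (‖D‖ * (5 / 4 * ‖x‖) * ‖ξ‖) * ‖ξ‖ := by
          refine mul_le_mul_of_nonneg_right ((hD _).trans ?_) (norm_nonneg _)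
          gcongr
          exact (hn x).2
      _ = (‖x‖ * ‖D‖) * (5 / 4 * ‖ξ‖ ^ 2) := by ring
      _ ≤ 1 / 8 * (5 / 4 * ‖ξ‖ ^ 2) := by gcongr
      _ = _ := by ring
  have e₃ : (3 / 4 * ‖ξ‖) ^ 2 ≤ ‖S.op x ξ‖ ^ 2 := by
    have := (hn ξ).1
    gcongr
  have := (abs_le.1 e₁).1
  have := (abs_le.1 e₂).2
  nlinarith [sq_nonneg ‖ξ‖]

end GeomSetup

namespace IsHamFlow

variable {d : ℕ} {S : GeomSetup d} {Φ : ℝ → Ed d × Ed d → Ed d × Ed d}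

lemma hasDerivAt (hΦ : IsHamFlow S Φ) (w : Ed d × Ed d) (t : ℝ) :
    HasDerivAt (fun s => Φ s w) (S.hamField (Φ t w)) t := hΦ.2 w t

lemma hasDerivAt_fst (hΦ : IsHamFlow S Φ) (w : Ed d × Ed d) (t : ℝ) :
    HasDerivAt (fun s => (Φ s w).1) (S.hamField (Φ t w)).1 t := by
  have h := (hasFDerivAt_fst (𝕜 := ℝ) (p := Φ t w)).comp_hasDerivAt t (hΦ.hasDerivAt w t)
  exact h

lemma hasDerivAt_snd (hΦ : IsHamFlow S Φ) (w : Ed d × Ed d) (t : ℝ) :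
    HasDerivAt (fun s => (Φ s w).2) (S.hamField (Φ t w)).2 t := by
  have h := (hasFDerivAt_snd (𝕜 := ℝ) (p := Φ t w)).comp_hasDerivAt t (hΦ.hasDerivAt w t)
  exact h

lemma hasDerivAt_op (hΦ : IsHamFlow S Φ) (w : Ed d × Ed d) (t : ℝ) :
    HasDerivAt (fun s => S.op (Φ s w).1 (Φ s w).2)
      (fderiv ℝ S.op (Φ t w).1 (S.hamField (Φ t w)).1 (Φ t w).2 +
        S.op (Φ t w).1 (S.hamField (Φ t w)).2) t := by
  have h : HasDerivAt (fun s => S.op (Φ s w).1)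
      (fderiv ℝ S.op (Φ t w).1 (S.hamField (Φ t w)).1) t := by
    have h := (S.op_differentiable (Φ t w).1).hasFDerivAt.comp_hasDerivAt t
      (hΦ.hasDerivAt_fst w t)
    exact h
  exact h.clm_apply (hΦ.hasDerivAt_snd w t)

lemma pHam_const (hΦ : IsHamFlow S Φ) (w : Ed d × Ed d) (t : ℝ) :
    pHam S (Φ t w) = pHam S w := by
  have h : ∀ t, HasDerivAt (fun s => pHam S (Φ s w)) 0 t := fun t => by
    have h₁ := (hΦ.hasDerivAt_op w t).inner ℝ (hΦ.hasDerivAt_snd w t)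
    have h₂ : (fun s => pHam S (Φ s w)) =
        fun s => inner ℝ (S.op (Φ s w).1 (Φ s w).2) (Φ s w).2 := by
      funext s; exact S.pHam_eq _ _
    rw [h₂]
    refine h₁.congr_deriv ?_
    rw [inner_add_left, S.op_symm _ (S.hamField _).2, real_inner_comm (S.hamField _).2,
      S.inner_hamField_snd, S.hamField_fst]
    simp only [map_smul, smul_apply, inner_smul_left, conj_trivial]
    ring
  have := is_const_of_deriv_eq_zero (fun t => (h t).differentiableAt) (fun t => (h t).deriv) t 0
  simpa [hΦ.1] using this

lemma hasDerivAt_norm_sq (hΦ : IsHamFlow S Φ) (w : Ed d × Ed d) (t : ℝ) :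
    HasDerivAt (fun s => ‖(Φ s w).1‖ ^ 2)
      (4 * inner ℝ (Φ t w).1 (S.op (Φ t w).1 (Φ t w).2)) t := by
  refine (hΦ.hasDerivAt_fst w t).norm_sq.congr_deriv ?_
  rw [S.hamField_fst, inner_smul_right]
  ring

lemma hasDerivAt_radial (hΦ : IsHamFlow S Φ) (w : Ed d × Ed d) (t : ℝ) :
    HasDerivAt (fun s => (inner ℝ (Φ s w).1 (S.op (Φ s w).1 (Φ s w).2) : ℝ))
      (inner ℝ (Φ t w).1 (fderiv ℝ S.op (Φ t w).1 (S.hamField (Φ t w)).1 (Φ t w).2 +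
        S.op (Φ t w).1 (S.hamField (Φ t w)).2) +
      inner ℝ (S.hamField (Φ t w)).1 (S.op (Φ t w).1 (Φ t w).2)) t :=
  (hΦ.hasDerivAt_fst w t).inner ℝ (hΦ.hasDerivAt_op w t)

/-- Trajectories issued from a bounded set stay in a bounded set during bounded times. -/
lemma exists_bound (hΦ : IsHamFlow S Φ) (r T : ℝ) :
    ∃ M : ℝ, ∀ w, ‖w‖ ≤ r → ∀ t, |t| ≤ T → ‖Φ t w‖ ≤ M := by
  obtain ⟨A, hA, hop⟩ := S.exists_norm_op_le
  obtain ⟨m, hm, hell⟩ := S.exists_elliptic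
  set B := √(A * r ^ 2 / m)
  have hsnd : ∀ w : Ed d × Ed d, ‖w‖ ≤ r → ∀ t, ‖(Φ t w).2‖ ≤ B := fun w hw t => by
    refine Real.le_sqrt_of_sq_le ((le_div_iff₀' hm).2 ((hell (Φ t w).1 _).trans ?_))
    rw [← S.pHam_eq]
    change pHam S (Φ t w) ≤ _
    rw [hΦ.pHam_const]
    change pHam S (w.1, w.2) ≤ _
    rw [S.pHam_eq]
    have hw₂ : ‖w.2‖ ≤ r := (norm_snd_le w).trans hw
    calc _ ≤ ‖S.op w.1 w.2‖ * ‖w.2‖ := real_inner_le_norm _ _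
      _ ≤ (A * ‖w.2‖) * ‖w.2‖ := by
          gcongr
          exact (S.op w.1).le_of_opNorm_le (hop _) _
      _ = A * ‖w.2‖ ^ 2 := by ring
      _ ≤ A * r ^ 2 := by gcongr
  refine ⟨max (r + 2 * (A * B) * T) B, fun w hw t ht => ?_⟩
  rw [Prod.norm_def]
  refine max_le_max ?_ (hsnd w hw t)
  have h := Convex.norm_image_sub_le_of_norm_hasDerivWithin_le (s := Set.univ) (x := 0) (y := t)
    (C := 2 * (A * B)) (fun s _ => (hΦ.hasDerivAt_fst w s).hasDerivWithinAt) (fun s _ => by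
      rw [S.hamField_fst, norm_smul, Real.norm_ofNat]
      gcongr
      exact (S.op _).le_of_opNorm_le_of_le (hop _) (hsnd w hw s)) convex_univ trivial trivial
  rw [hΦ.1, sub_zero, Real.norm_eq_abs] at h
  have h₂ : 2 * (A * B) * |t| ≤ 2 * (A * B) * T := by
    have : 0 ≤ B := Real.sqrt_nonneg _
    gcongr
  linarith [norm_le_norm_add_norm_sub' (Φ t w).1 w.1, norm_fst_le w]

/-- On bounded sets and for bounded times, the flow is Lipschitz in the initial datum. -/
lemma exists_lipschitzOnWith (hΦ : IsHamFlow S Φ) (r T : ℝ) :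
    ∃ K : ℝ≥0, ∀ t, |t| ≤ T → LipschitzOnWith K (Φ t) (Metric.closedBall 0 r) := by
  obtain ⟨M, hM⟩ := hΦ.exists_bound r T
  obtain ⟨L, hL⟩ := S.hamField_contDiff.contDiffOn.exists_lipschitzOnWith one_ne_zero
    (convex_closedBall (0 : Ed d × Ed d) M) (isCompact_closedBall _ _)
  have key : ∀ σ : ℝ, |σ| = 1 → ∀ t, 0 ≤ t → t ≤ T → ∀ w ∈ Metric.closedBall (0 : Ed d × Ed d) r,
      ∀ w' ∈ Metric.closedBall (0 : Ed d × Ed d) r,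
      dist (Φ (σ * t) w) (Φ (σ * t) w') ≤ dist w w' * Real.exp (L * t) := by
    intro σ hσ t ht htT w hw w' hw'
    have hd : ∀ v s, HasDerivAt (fun s => Φ (σ * s) v) (σ • S.hamField (Φ (σ * s) v)) s := by
      intro v s
      have := (hΦ.hasDerivAt v (σ * s)).scomp s ((hasDerivAt_id s).const_mul σ)
      simpa [Function.comp_def] using this
    have hmem : ∀ v ∈ Metric.closedBall (0 : Ed d × Ed d) r, ∀ s ∈ Set.Ico 0 T,
        Φ (σ * s) v ∈ Metric.closedBall (0 : Ed d × Ed d) M := fun v hv s hs => by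
      rw [mem_closedBall_zero_iff] at hv ⊢
      refine hM v hv _ ?_
      rw [abs_mul, hσ, one_mul, abs_of_nonneg hs.1]
      exact hs.2.le
    have hlip : LipschitzOnWith L (fun v => σ • S.hamField v) (Metric.closedBall 0 M) := by
      refine LipschitzOnWith.of_dist_le_mul fun x hx y hy => ?_
      rw [dist_smul₀, Real.norm_eq_abs, hσ, one_mul]
      exact hL.dist_le_mul x hx y hy
    have := dist_le_of_trajectories_ODE_of_mem (a := 0) (b := T)
      (v := fun _ v => σ • S.hamField v) (s := fun _ => Metric.closedBall 0 M)
      (f := fun s => Φ (σ * s) w) (g := fun s => Φ (σ * s) w') (δ := dist w w') (K := L)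
      (fun _ _ => hlip)
      (fun s _ => (hd w s).continuousAt.continuousWithinAt)
      (fun s _ => (hd w s).hasDerivWithinAt) (hmem w hw)
      (fun s _ => (hd w' s).continuousAt.continuousWithinAt)
      (fun s _ => (hd w' s).hasDerivWithinAt) (hmem w' hw') (by simp [hΦ.1]) t ⟨ht, htT⟩
    simpa using this
  refine ⟨Real.toNNReal (Real.exp (L * T)), fun t ht =>
    LipschitzOnWith.of_dist_le_mul fun w hw w' hw' => ?_⟩
  rw [Real.coe_toNNReal _ (Real.exp_pos _).le]
  have hle : dist w w' * Real.exp (L * |t|) ≤ Real.exp (L * T) * dist w w' := by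
    rw [mul_comm]
    gcongr
  refine le_trans ?_ hle
  rcases abs_cases t with ⟨h, -⟩ | ⟨h, -⟩
  · simpa [h] using key 1 (by simp) |t| (abs_nonneg t) ht w hw w' hw'
  · simpa [h] using key (-1) (by simp) |t| (abs_nonneg t) ht w hw w' hw'

/-- The flow is jointly continuous. -/
lemma continuous (hΦ : IsHamFlow S Φ) : Continuous fun q : ℝ × (Ed d × Ed d) => Φ q.1 q.2 := by
  refine continuous_iff_continuousAt.2 fun ⟨t, w⟩ => ?_
  obtain ⟨K, hK⟩ := hΦ.exists_lipschitzOnWith (‖w‖ + 1) (|t| + 1)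
  have h := continuousOn_prod_of_continuousOn_lipschitzOnWith'
    (fun q : ℝ × (Ed d × Ed d) => Φ q.1 q.2) K (s := {s | |s| ≤ |t| + 1})
    (t := Metric.closedBall (0 : Ed d × Ed d) (‖w‖ + 1)) (fun s hs => hK s hs)
    (fun v _ s _ => (hΦ.hasDerivAt v s).continuousAt.continuousWithinAt)
  refine h.continuousAt (prod_mem_nhds ?_ ?_)
  · filter_upwards [continuous_abs.continuousAt.eventually_lt (g := fun _ => |t| + 1)
      continuousAt_const (lt_add_one |t|)] with s hs using le_of_lt hs
  · filter_upwards [continuous_norm.continuousAt.eventually_lt (g := fun _ => ‖w‖ + 1)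
      continuousAt_const (lt_add_one ‖w‖)] with v hv
    simpa using hv.le

end IsHamFlow

/-- If `f` is convex wherever it exceeds the level `c`, then once it is above this level and
increasing it grows at least linearly. -/
lemma linear_growth_of_convex_above {f f₁ f₂ : ℝ → ℝ} {c t₀ : ℝ}
    (hf : ∀ t, HasDerivAt f (f₁ t) t) (hf₁ : ∀ t, HasDerivAt f₁ (f₂ t) t)
    (hconv : ∀ t, c < f t → 0 ≤ f₂ t) (h₀ : c < f t₀) (h₁ : 0 < f₁ t₀) {t : ℝ} (ht : t₀ ≤ t) :
    f t₀ + f₁ t₀ * (t - t₀) ≤ f t := by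
  have growth : ∀ τ, t₀ ≤ τ → (∀ s ∈ Set.Ioo t₀ τ, c < f s) →
      f t₀ + f₁ t₀ * (τ - t₀) ≤ f τ := by
    intro τ hτ habove
    have hmono : MonotoneOn f₁ (Set.Icc t₀ τ) :=
      monotoneOn_of_deriv_nonneg (convex_Icc _ _)
        (fun s _ => (hf₁ s).continuousAt.continuousWithinAt)
        (fun s _ => (hf₁ s).differentiableAt.differentiableWithinAt) (fun s hs => by
          rw [interior_Icc] at hs
          rw [(hf₁ s).deriv]
          exact hconv s (habove s hs))
    have := (convex_Icc t₀ τ).mul_sub_le_image_sub_of_le_deriv (f := f) (C := f₁ t₀)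
      (fun s _ => (hf s).continuousAt.continuousWithinAt)
      (fun s _ => (hf s).differentiableAt.differentiableWithinAt) (fun s hs => by
        rw [(hf s).deriv]
        have hs' := interior_subset hs
        exact hmono ⟨le_rfl, hτ⟩ hs' hs'.1) t₀ ⟨le_rfl, hτ⟩ τ ⟨hτ, le_rfl⟩ hτ
    linarith
  refine growth t ht ?_
  by_contra! hcon
  obtain ⟨s, hs, hsc⟩ := hcon
  have hcont : Continuous f := continuous_iff_continuousAt.2 fun s => (hf s).continuousAt
  obtain ⟨τ, ⟨hτ, hτc⟩, hmin⟩ :=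
    (isCompact_Icc.inter_right (isClosed_le hcont continuous_const) :
      IsCompact (Set.Icc t₀ t ∩ {s | f s ≤ c})).exists_isLeast ⟨s, ⟨hs.1.le, hs.2.le⟩, hsc⟩
  have := growth τ hτ.1 fun u hu => by
    by_contra! hcu
    exact (hmin ⟨⟨hu.1.le, hu.2.le.trans hτ.2⟩, hcu⟩).not_gt hu.2
  have h₂ : 0 ≤ f₁ t₀ * (τ - t₀) := mul_nonneg h₁.le (sub_nonneg.2 hτ.1)
  have h₃ : f τ ≤ c := hτc
  linarith

/-- An upward crossing of a level is followed by a point above this level with positive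
derivative. -/
lemma exists_deriv_pos_above {f f₁ : ℝ → ℝ} {c a b : ℝ} (hf : ∀ t, HasDerivAt f (f₁ t) t)
    (hab : a ≤ b) (ha : f a ≤ c) (hb : c < f b) : ∃ t, a ≤ t ∧ c < f t ∧ 0 < f₁ t := by
  have hcont : Continuous f := continuous_iff_continuousAt.2 fun s => (hf s).continuousAt
  obtain ⟨τ, ⟨hτ, hτc⟩, hmax⟩ :=
    (isCompact_Icc.inter_right (isClosed_le hcont continuous_const) :
      IsCompact (Set.Icc a b ∩ {s | f s ≤ c})).exists_isGreatest ⟨a, ⟨le_rfl, hab⟩, ha⟩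
  have hτc' : f τ ≤ c := hτc
  have hτb : τ < b := hτ.2.lt_of_ne fun h => by subst h; linarith
  obtain ⟨s, hs, hslope⟩ := exists_hasDerivAt_eq_slope f f₁ hτb hcont.continuousOn fun x _ => hf x
  refine ⟨s, hτ.1.trans hs.1.le, ?_, ?_⟩
  · by_contra! hcs
    exact (hmax ⟨⟨hτ.1.trans hs.1.le, hs.2.le⟩, hcs⟩).not_gt hs.1
  · rw [hslope]
    exact div_pos (by linarith) (sub_pos.2 hτb)

namespace IsHamFlow

variable {d : ℕ} {S : GeomSetup d} {Φ : ℝ → Ed d × Ed d → Ed d × Ed d}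

/-- A trajectory that is unbounded in the direction of time `σ` escapes at least linearly, uniformly
for neighbouring initial data. -/
lemma exists_uniform_escape (hΦ : IsHamFlow S Φ) {σ : ℝ} {w : Ed d × Ed d}
    (hw : w ∉ OmegaB Φ σ) :
    ∃ U ∈ 𝓝 w, ∃ t₀ ε : ℝ, 0 < ε ∧
      ∀ v ∈ U, ∀ t, t₀ ≤ t → ε * (t - t₀) ≤ ‖(Φ (σ * t) v).1‖ ^ 2 := by
  obtain ⟨R, hR⟩ := S.exists_near_flat
  set c := max (R ^ 2) (‖w.1‖ ^ 2)
  set F₁ : Ed d × Ed d → ℝ := fun v => σ * (4 * inner ℝ v.1 (S.op v.1 v.2))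
  have hf : ∀ v t, HasDerivAt (fun s => ‖(Φ (σ * s) v).1‖ ^ 2) (F₁ (Φ (σ * t) v)) t := fun v t => by
    have := (hΦ.hasDerivAt_norm_sq v (σ * t)).scomp t ((hasDerivAt_id t).const_mul σ)
    simpa [Function.comp_def, F₁] using this
  have hf₁ : ∀ v t, HasDerivAt (fun s => F₁ (Φ (σ * s) v)) _ t := fun v t =>
    (((hΦ.hasDerivAt_radial v (σ * t)).scomp t ((hasDerivAt_id t).const_mul σ)).const_mul
      4).const_mul σ
  have hF₁ : Continuous F₁ := by
    have := S.op_contDiff.continuous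
    fun_prop
  obtain ⟨b, hb, hcb⟩ : ∃ b, 0 ≤ b ∧ c < ‖(Φ (σ * b) w).1‖ ^ 2 := by
    by_contra! h
    exact hw ⟨√c, fun t ht => Real.le_sqrt_of_sq_le (h t ht)⟩
  obtain ⟨t₀, -, hct₀, hdt₀⟩ := exists_deriv_pos_above (hf w) hb
    (by simp [hΦ.1, c]) hcb
  have hcΦ : Continuous fun v => Φ (σ * t₀) v :=
    hΦ.continuous.comp (continuous_const.prodMk continuous_id)
  set ε := F₁ (Φ (σ * t₀) w) / 2
  have hε : 0 < ε := half_pos hdt₀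
  refine ⟨{v | c < ‖(Φ (σ * t₀) v).1‖ ^ 2} ∩ {v | ε < F₁ (Φ (σ * t₀) v)},
    IsOpen.mem_nhds ((isOpen_lt continuous_const (by fun_prop)).inter
      (isOpen_lt continuous_const (hF₁.comp hcΦ))) ⟨hct₀, half_lt_self hdt₀⟩,
    t₀, ε, hε, fun v ⟨hv₁, hv₂⟩ t ht => ?_⟩
  have hv₂' : ε < F₁ (Φ (σ * t₀) v) := hv₂
  have := linear_growth_of_convex_above (hf v) (hf₁ v) (fun s hs => ?_) hv₁ (hε.trans hv₂) ht
  · have h₁ : ε * (t - t₀) ≤ F₁ (Φ (σ * t₀) v) * (t - t₀) :=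
      mul_le_mul_of_nonneg_right hv₂'.le (sub_nonneg.2 ht)
    have h₂ := sq_nonneg ‖(Φ (σ * t₀) v).1‖
    linarith
  · have hs' : R ≤ ‖(Φ (σ * s) v).1‖ :=
      (lt_of_pow_lt_pow_left₀ 2 (norm_nonneg _) ((le_max_left _ _).trans_lt hs)).le
    obtain ⟨h₀, h₁⟩ := hR _ hs'
    have h := S.radial_convexity h₀ h₁
    refine (mul_nonneg (mul_nonneg zero_le_four (mul_self_nonneg σ)) h).trans_eq ?_
    simp only [mul_one, smul_eq_mul]
    ring

end IsHamFlow

/-- A trajectory tending to infinity in the direction of time `σ` is not bounded. -/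
lemma disjoint_omegaB_omegaInf {d : ℕ} (Φ : ℝ → Ed d × Ed d → Ed d × Ed d) (σ : ℝ) :
    Disjoint (OmegaB Φ σ) (OmegaInf Φ σ) := by
  rw [Set.disjoint_left]
  rintro w ⟨M, hM⟩ (hw : Tendsto _ _ _)
  obtain ⟨t, ht, ht₀⟩ := ((hw.eventually_gt_atTop M).and (eventually_ge_atTop 0)).exists
  exact (hM t ht₀).not_gt ht

namespace IsHamFlow

variable {d : ℕ} {S : GeomSetup d} {Φ : ℝ → Ed d × Ed d → Ed d × Ed d}

/-- Initial data near a non-trapped one leave every ball in a common time. -/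
lemma exists_uniform_time (hΦ : IsHamFlow S Φ) {σ : ℝ} {w : Ed d × Ed d}
    (hw : w ∉ OmegaB Φ σ) :
    ∃ U ∈ 𝓝 w, ∀ R : ℝ, ∃ T : ℝ, ∀ v ∈ U, ∀ t, T ≤ t → R ≤ ‖(Φ (σ * t) v).1‖ := by
  obtain ⟨U, hU, t₀, ε, hε, h⟩ := hΦ.exists_uniform_escape hw
  refine ⟨U, hU, fun R => ⟨t₀ + R ^ 2 / ε, fun v hv t ht => ?_⟩⟩
  have hR : 0 ≤ R ^ 2 / ε := by positivity
  refine le_of_sq_le_sq ?_ (norm_nonneg _)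
  refine le_trans ?_ (h v hv t (by linarith))
  have : R ^ 2 / ε ≤ t - t₀ := by linarith
  rwa [div_le_iff₀' hε] at this

lemma omegaInf_eq_compl (hΦ : IsHamFlow S Φ) {σ : ℝ} :
    OmegaInf Φ σ = (OmegaB Φ σ)ᶜ := by
  refine (disjoint_omegaB_omegaInf Φ σ).subset_compl_left.antisymm fun w hw => ?_
  obtain ⟨U, hU, h⟩ := hΦ.exists_uniform_time hw
  refine tendsto_atTop.2 fun R => ?_
  obtain ⟨T, hT⟩ := h R
  filter_upwards [eventually_ge_atTop T] with t ht using hT w (mem_of_mem_nhds hU) t ht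

lemma isOpen_omegaInf (hΦ : IsHamFlow S Φ) {σ : ℝ} : IsOpen (OmegaInf Φ σ) := by
  refine isOpen_iff_mem_nhds.2 fun w hw => ?_
  rw [hΦ.omegaInf_eq_compl] at hw
  obtain ⟨U, hU, h⟩ := hΦ.exists_uniform_time hw
  filter_upwards [hU] with v hv
  refine tendsto_atTop.2 fun R => ?_
  obtain ⟨T, hT⟩ := h R
  filter_upwards [eventually_ge_atTop T] with t ht using hT v hv t ht

lemma isClosed_omegaB (hΦ : IsHamFlow S Φ) {σ : ℝ} : IsClosed (OmegaB Φ σ) := by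
  rw [← isOpen_compl_iff, ← hΦ.omegaInf_eq_compl]
  exact hΦ.isOpen_omegaInf

lemma exists_uniform_time_of_isCompact (hΦ : IsHamFlow S Φ) {σ : ℝ}
    {K : Set (Ed d × Ed d)} (hK : IsCompact K) (hKσ : K ⊆ OmegaInf Φ σ) (R : ℝ) :
    ∃ T : ℝ, ∀ v ∈ K, ∀ t, T ≤ t → R ≤ ‖(Φ (σ * t) v).1‖ := by
  refine hK.induction_on (p := fun A => ∃ T : ℝ, ∀ v ∈ A, ∀ t, T ≤ t → R ≤ ‖(Φ (σ * t) v).1‖)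
    ⟨0, by simp⟩ (fun A B hAB ⟨T, hT⟩ => ⟨T, fun v hv => hT v (hAB hv)⟩)
    (fun A B ⟨T, hT⟩ ⟨T', hT'⟩ => ⟨max T T', ?_⟩) (fun w hw => ?_)
  · rintro v (hv | hv) t ht
    · exact hT v hv t ((le_max_left _ _).trans ht)
    · exact hT' v hv t ((le_max_right _ _).trans ht)
  · have hw' := hKσ hw
    rw [hΦ.omegaInf_eq_compl] at hw'
    obtain ⟨U, hU, h⟩ := hΦ.exists_uniform_time hw'
    exact ⟨U, mem_nhdsWithin_of_mem_nhds hU, h R⟩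

lemma exists_uniform_time_abs (hΦ : IsHamFlow S Φ) {K : Set (Ed d × Ed d)} (hK : IsCompact K)
    (hKinf : K ⊆ OmegaInf Φ 1 ∩ OmegaInf Φ (-1)) (R : ℝ) :
    ∃ T : ℝ, 0 ≤ T ∧ ∀ v ∈ K, ∀ t : ℝ, T ≤ |t| → R ≤ ‖(Φ t v).1‖ := by
  obtain ⟨T, hT⟩ := hΦ.exists_uniform_time_of_isCompact (σ := 1) hK
    (fun v hv => (hKinf hv).1) R
  obtain ⟨T', hT'⟩ := hΦ.exists_uniform_time_of_isCompact (σ := -1) hK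
    (fun v hv => (hKinf hv).2) R
  refine ⟨max 0 (max T T'), le_max_left _ _, fun v hv t ht => ?_⟩
  obtain ⟨-, ht⟩ := max_le_iff.1 ht
  obtain ⟨h₁, h₂⟩ := max_le_iff.1 ht
  rcases abs_cases t with ⟨h, -⟩ | ⟨h, -⟩
  · simpa [h] using hT v hv |t| h₁
  · simpa [h] using hT' v hv |t| h₂

lemma isClosed_iUnion_image (hΦ : IsHamFlow S Φ) {K : Set (Ed d × Ed d)} (hK : IsCompact K)
    (hKinf : K ⊆ OmegaInf Φ 1 ∩ OmegaInf Φ (-1)) :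
    IsClosed (⋃ t : ℝ, (fun w => Φ (-t) w) '' K) := by
  refine isClosed_of_closure_subset fun w hw => ?_
  obtain ⟨T, -, hT⟩ := hΦ.exists_uniform_time_abs hK hKinf (‖w.1‖ + 1)
  have hcomp : IsCompact ((fun q : ℝ × (Ed d × Ed d) => Φ (-q.1) q.2) '' (Set.Icc (-T) T ×ˢ K)) :=
    (isCompact_Icc.prod hK).image
      (hΦ.continuous.comp (continuous_fst.neg.prodMk continuous_snd))
  have hO : IsOpen {v : Ed d × Ed d | ‖v.1‖ < ‖w.1‖ + 1} :=
    isOpen_lt (by fun_prop) continuous_const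
  have hw' : w ∈ closure ({v : Ed d × Ed d | ‖v.1‖ < ‖w.1‖ + 1} ∩
      ⋃ t : ℝ, (fun w => Φ (-t) w) '' K) := hO.inter_closure ⟨lt_add_one ‖w.1‖, hw⟩
  have hsub : {v : Ed d × Ed d | ‖v.1‖ < ‖w.1‖ + 1} ∩ (⋃ t : ℝ, (fun w => Φ (-t) w) '' K) ⊆
      (fun q : ℝ × (Ed d × Ed d) => Φ (-q.1) q.2) '' (Set.Icc (-T) T ×ˢ K) := by
    rintro u ⟨hu, hu'⟩
    obtain ⟨t, v, hv, rfl⟩ := Set.mem_iUnion.1 hu'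
    refine ⟨(t, v), ⟨abs_le.1 ?_, hv⟩, rfl⟩
    by_contra! ht
    exact (hT v hv (-t) (by rw [abs_neg]; exact ht.le)).not_gt hu
  obtain ⟨⟨t, v⟩, ⟨-, hv⟩, rfl⟩ := closure_minimal hsub hcomp.isClosed hw'
  exact Set.mem_iUnion.2 ⟨t, v, hv, rfl⟩

end IsHamFlow

/-- **Structure of the trapped and non-trapped sets** (Proposition 8.3).
(i) `ℝ^{2d} = Ω_b^± ⊔ Ω_∞^±` (disjoint unions); in particular
`ℝ^{2d} = Ω_b⁺ ∪ Ω_b⁻ ∪ Ω_∞`.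
(ii) `Ω_∞⁺, Ω_∞⁻, Ω_∞` are open and `Ω_b⁺, Ω_b⁻, Ω_b` are closed.
(iii) For `K ⊆ Ω_∞` compact and every `R ≥ 0` there is `T ≥ 0` with `|X(t,v)| ≥ R`
for `v ∈ K`, `|t| ≥ T`; moreover `⋃_{t ∈ ℝ} φ^{-t}(K)` is closed. -/
theorem trapped_set_properties
    (d : ℕ) (hd : 3 ≤ d) (S : GeomSetup d)
    (Φ : ℝ → Ed d × Ed d → Ed d × Ed d) (hΦ : IsHamFlow S Φ) :
    ((OmegaB Φ 1 ∪ OmegaInf Φ 1 = Set.univ) ∧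
      Disjoint (OmegaB Φ 1) (OmegaInf Φ 1) ∧
      (OmegaB Φ (-1) ∪ OmegaInf Φ (-1) = Set.univ) ∧
      Disjoint (OmegaB Φ (-1)) (OmegaInf Φ (-1)) ∧
      OmegaB Φ 1 ∪ OmegaB Φ (-1) ∪ (OmegaInf Φ 1 ∩ OmegaInf Φ (-1)) = Set.univ) ∧
    (IsOpen (OmegaInf Φ 1) ∧ IsOpen (OmegaInf Φ (-1)) ∧
      IsOpen (OmegaInf Φ 1 ∩ OmegaInf Φ (-1)) ∧
      IsClosed (OmegaB Φ 1) ∧ IsClosed (OmegaB Φ (-1)) ∧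
      IsClosed (OmegaB Φ 1 ∩ OmegaB Φ (-1))) ∧
    ∀ K : Set (Ed d × Ed d), IsCompact K → K ⊆ OmegaInf Φ 1 ∩ OmegaInf Φ (-1) →
      (∀ R : ℝ, 0 ≤ R → ∃ T : ℝ, 0 ≤ T ∧
        ∀ v ∈ K, ∀ t : ℝ, T ≤ |t| → R ≤ ‖(Φ t v).1‖) ∧
      IsClosed (⋃ t : ℝ, (fun w => Φ (-t) w) '' K) := by
  refine ⟨⟨?_, disjoint_omegaB_omegaInf Φ 1, ?_, disjoint_omegaB_omegaInf Φ (-1), ?_⟩,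
    ⟨hΦ.isOpen_omegaInf, hΦ.isOpen_omegaInf,
      hΦ.isOpen_omegaInf.inter hΦ.isOpen_omegaInf,
      hΦ.isClosed_omegaB, hΦ.isClosed_omegaB,
      hΦ.isClosed_omegaB.inter hΦ.isClosed_omegaB⟩,
    fun K hK hKinf => ⟨fun R _ => hΦ.exists_uniform_time_abs hK hKinf R,
      hΦ.isClosed_iUnion_image hK hKinf⟩⟩
  · rw [hΦ.omegaInf_eq_compl, Set.union_compl_self]
  · rw [hΦ.omegaInf_eq_compl, Set.union_compl_self]
  · rw [hΦ.omegaInf_eq_compl, hΦ.omegaInf_eq_compl, ← Set.compl_union,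
      Set.union_compl_self]
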